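/- Define the quadratic form σ(p,q) := ⟨p,p⟩_L + ⟨Mq,Mq⟩_L + 2·Re⟨Mp,q⟩_L for p,q ∈ ℂ_d[z]. Then the following are equivalent: (i) σ(p,q) ≥ 0 for all p,q ∈ ℂ_d[z] (σ is positive semidefinite, i.e. its only non-positive eigenvalue is zero); (ii) there exist an integer N ≤ d+1, points a_1, …, a_N ∈ ℂ and weights c_1, …, c_N > 0 such that s(j,k) = Σ_{m=1}^N c_m a_m^j conj(a_m)^k for all j,k ≤ d+1 with j+k ≤ 2d+1 (a quadrature formula L(p·q̄) = Σ_m c_m p(a_m) conj(q(a_m)) valid for all p,q ∈ ℂ_{d+1}[z] with deg(p·q̄) ≤ 2d+1). -/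

import Mathlib

open Finset
open scoped BigOperators

noncomputable section

/-- Sesquilinear moment form on coefficient vectors of length `n`:
`L(p·q̄) = ∑_{j,k} p_j conj(q_k) s(j,k)`. -/
def momForm (n : ℕ) (s : ℕ → ℕ → ℂ) (p q : Fin n → ℂ) : ℂ :=
  ∑ j : Fin n, ∑ k : Fin n, p j * (starRingEnd ℂ) (q k) * s (j : ℕ) (k : ℕ)

/-- The index set of monomials `z^a z̄^b` of total degree at most `n`. -/
def pairSet (n : ℕ) : Finset (ℕ × ℕ) :=
  (Finset.range (n + 1) ×ˢ Finset.range (n + 1)).filter fun ab => ab.1 + ab.2 ≤ n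

/-- `L(|f|²)` for a polynomial `f(z,z̄) = ∑ f_{ab} z^a z̄^b` of total degree at most `n`. -/
def sqForm (n : ℕ) (s : ℕ → ℕ → ℂ) (f : ℕ × ℕ → ℂ) : ℂ :=
  ∑ ab ∈ pairSet n, ∑ ab' ∈ pairSet n,
    f ab * (starRingEnd ℂ) (f ab') * s (ab.1 + ab'.2) (ab.2 + ab'.1)

lemma normal_of_form {E : Type*} [NormedAddCommGroup E] [InnerProductSpace ℂ E]
    [FiniteDimensional ℂ E] (T : E →ₗ[ℂ] E)
    (h : ∀ p q : E, 0 ≤ (inner ℂ p p).re + (inner ℂ (T q) (T q)).re + 2 * (inner ℂ q (T p)).re) :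
    T.adjoint * T = T * T.adjoint := by
  have hpos : (T.adjoint * T - T * T.adjoint).IsPositive := by
    constructor
    · intro x y
      simp [inner_sub_left, inner_sub_right, LinearMap.adjoint_inner_left, LinearMap.adjoint_inner_right]
      rw [← LinearMap.adjoint_inner_right T, LinearMap.adjoint_inner_left T]
    · intro x
      have := h (-(T.adjoint x)) x
      simp only [map_neg, inner_neg_left, inner_neg_right, neg_neg, Complex.neg_re] at this
      have e1 := LinearMap.adjoint_inner_left T x (T x)
      have e2 := LinearMap.adjoint_inner_left T (T.adjoint x) x
      have e3 := LinearMap.adjoint_inner_right T (T.adjoint x) x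
      simp only [LinearMap.sub_apply, Module.End.mul_apply, inner_sub_left, map_sub,
        RCLike.re_to_complex]
      rw [← e2] at this
      rw [e1, ← e3]
      linarith
  have b := stdOrthonormalBasis ℂ E
  have h2 := (LinearMap.posSemidef_toMatrix_iff b).2 hpos
  have h3 : (T.adjoint * T - T * T.adjoint).toMatrix b.toBasis b.toBasis = 0 := by
    rw [← h2.trace_eq_zero_iff, ← LinearMap.trace_eq_matrix_trace, map_sub, LinearMap.trace_mul_comm,
      sub_self]
  rw [← sub_eq_zero]
  exact (LinearMap.toMatrix b.toBasis b.toBasis).map_eq_zero_iff.1 h3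

lemma spectral_moments {E : Type*} [NormedAddCommGroup E] [InnerProductSpace ℂ E]
    [FiniteDimensional ℂ E] (T : E →ₗ[ℂ] E)
    (h : ∀ p q : E, 0 ≤ (inner ℂ p p).re + (inner ℂ (T q) (T q)).re + 2 * (inner ℂ q (T p)).re)
    (v : E) :
    ∃ N : ℕ, N ≤ Module.finrank ℂ E ∧ ∃ a : Fin N → ℂ, ∃ c : Fin N → ℝ, (∀ m, 0 < c m) ∧
      ∀ j k : ℕ, inner ℂ ((T ^ k) v) ((T ^ j) v)
        = ∑ m, (c m : ℂ) * a m ^ j * (starRingEnd ℂ) (a m) ^ k := by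
  have hn := normal_of_form T h
  set S := T.adjoint with hS
  have h2 : (starRingEnd ℂ) 2 = 2 := Complex.conj_ofNat 2
  have hA : ((1/2 : ℂ) • (T + S)).IsSymmetric := by
    intro x y
    simp [inner_smul_left, inner_smul_right, inner_add_left, inner_add_right, hS, h2,
      LinearMap.adjoint_inner_left, LinearMap.adjoint_inner_right]
    rw [add_comm]
  have hB : ((1/2 * Complex.I : ℂ) • (S - T)).IsSymmetric := by
    intro x y
    simp [inner_smul_left, inner_smul_right, inner_sub_left, inner_sub_right, hS, h2,
      LinearMap.adjoint_inner_left, LinearMap.adjoint_inner_right]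
    ring
  have hT : T = (1/2 : ℂ) • (T + S) + Complex.I • ((1/2 * Complex.I : ℂ) • (S - T)) := by
    rw [smul_smul]
    have : Complex.I * (1/2 * Complex.I) = -(1/2) := by
      linear_combination (1/2) * Complex.I_mul_I
    rw [this]; module
  have hC : Commute ((1/2 : ℂ) • (T + S)) ((1/2 * Complex.I : ℂ) • (S - T)) := by
    apply Commute.smul_left; apply Commute.smul_right
    show (T + S) * (S - T) = (S - T) * (T + S)
    rw [add_mul, mul_sub, mul_sub, sub_mul, mul_add, mul_add, hn]; abel
  generalize ((1/2 : ℂ) • (T + S)) = A at *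
  generalize ((1/2 * Complex.I : ℂ) • (S - T)) = B at *
  have htop := hA.iSup_iSup_eigenspace_inf_eigenspace_eq_top_of_commute hB hC
  rw [iSup_comm, ← iSup_prod (f := fun i : ℂ × ℂ => Module.End.eigenspace A i.2 ⊓ Module.End.eigenspace B i.1)] at htop
  have horth := hA.orthogonalFamily_eigenspace_inf_eigenspace hB
  have hv : v ∈ ⨆ i : ℂ × ℂ, Module.End.eigenspace A i.2 ⊓ Module.End.eigenspace B i.1 := htop ▸ Submodule.mem_top
  rw [Submodule.mem_iSup_iff_exists_finsupp] at hv
  obtain ⟨f, hf, hfv⟩ := hv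
  have ho : ∀ i j, i ≠ j → inner ℂ (f i) (f j) = 0 := fun i j hij =>
    horth hij ⟨f i, hf i⟩ ⟨f j, hf j⟩
  have hli : LinearIndependent ℂ (fun i : f.support => f i) := by
    apply linearIndependent_of_ne_zero_of_inner_eq_zero
    · intro i; exact Finsupp.mem_support_iff.1 i.2
    · intro i j hij; exact ho _ _ (fun h => hij (Subtype.ext h))
  have hcard := hli.fintype_card_le_finrank
  have hTf : ∀ i, T (f i) = (i.2 + Complex.I * i.1) • f i := by
    intro i
    have h1 := Module.End.mem_eigenspace_iff.1 (hf i).1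
    have h2 := Module.End.mem_eigenspace_iff.1 (hf i).2
    rw [hT]
    simp only [LinearMap.add_apply, LinearMap.smul_apply, h1, h2]
    rw [smul_smul, ← add_smul]
  have hTp : ∀ i (j : ℕ), (T ^ j) (f i) = (i.2 + Complex.I * i.1) ^ j • f i := by
    intro i j
    induction j with
    | zero => simp
    | succ n ih => rw [pow_succ', Module.End.mul_apply, ih, map_smul, hTf, smul_smul, pow_succ]
  have hTv : ∀ j : ℕ, (T ^ j) v = ∑ i : f.support, (i.1.2 + Complex.I * i.1.1) ^ j • f i := by
    intro j
    rw [← hfv, Finsupp.sum, map_sum, ← Finset.sum_coe_sort]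
    exact Finset.sum_congr rfl fun i _ => hTp _ _
  let e := Fintype.equivFin f.support
  refine ⟨_, hcard, fun m => ((e.symm m).1.2 + Complex.I * (e.symm m).1.1),
    fun m => ‖f (e.symm m)‖ ^ 2, ?_, ?_⟩
  · intro m
    have : f (e.symm m) ≠ 0 := Finsupp.mem_support_iff.1 (e.symm m).2
    positivity
  · intro j k
    rw [hTv, hTv, sum_inner]
    rw [← e.symm.sum_comp]
    refine Finset.sum_congr rfl fun m _ => ?_
    rw [inner_smul_left, inner_sum, Finset.sum_eq_single (e.symm m)]
    · rw [inner_smul_right, inner_self_eq_norm_sq_to_K]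
      simp only [map_pow]
      push_cast
      simp only [Complex.coe_algebraMap]
      ring
    · intro b _ hb
      rw [inner_smul_right, ho _ _ (fun h => hb (Subtype.ext h.symm)), mul_zero]
    · simp

lemma core_moments {V : Type*} [AddCommGroup V] [Module ℂ V] [FiniteDimensional ℂ V]
    (cd : InnerProductSpace.Core ℂ V) (T : V →ₗ[ℂ] V)
    (h : ∀ p q : V, 0 ≤ (cd.inner p p).re + (cd.inner (T q) (T q)).re + 2 * (cd.inner q (T p)).re)
    (v : V) :
    ∃ N : ℕ, N ≤ Module.finrank ℂ V ∧ ∃ a : Fin N → ℂ, ∃ c : Fin N → ℝ, (∀ m, 0 < c m) ∧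
      ∀ j k : ℕ, cd.inner ((T ^ k) v) ((T ^ j) v)
        = ∑ m, (c m : ℂ) * a m ^ j * (starRingEnd ℂ) (a m) ^ k := by
  let : NormedAddCommGroup V := cd.toNormedAddCommGroup
  let : InnerProductSpace ℂ V := InnerProductSpace.ofCore cd.toCore
  exact spectral_moments T h v

lemma momForm_add_left (n : ℕ) (s : ℕ → ℕ → ℂ) (p p' q : Fin n → ℂ) :
    momForm n s (p + p') q = momForm n s p q + momForm n s p' q := by
  simp only [momForm, ← Finset.sum_add_distrib, Pi.add_apply]
  exact Finset.sum_congr rfl fun _ _ => Finset.sum_congr rfl fun _ _ => by ring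

lemma momForm_add_right (n : ℕ) (s : ℕ → ℕ → ℂ) (p q q' : Fin n → ℂ) :
    momForm n s p (q + q') = momForm n s p q + momForm n s p q' := by
  simp only [momForm, ← Finset.sum_add_distrib, Pi.add_apply, map_add]
  exact Finset.sum_congr rfl fun _ _ => Finset.sum_congr rfl fun _ _ => by ring

lemma momForm_smul_right (n : ℕ) (s : ℕ → ℕ → ℂ) (r : ℂ) (p q : Fin n → ℂ) :
    momForm n s p (r • q) = (starRingEnd ℂ) r * momForm n s p q := by
  simp only [momForm, Finset.mul_sum, Pi.smul_apply, smul_eq_mul, map_mul]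
  exact Finset.sum_congr rfl fun _ _ => Finset.sum_congr rfl fun _ _ => by ring

lemma momForm_conj (d : ℕ) (s : ℕ → ℕ → ℂ)
    (hherm : ∀ j k : ℕ, j + k ≤ 2 * d + 2 → s j k = (starRingEnd ℂ) (s k j))
    (p q : Fin (d + 1) → ℂ) :
    (starRingEnd ℂ) (momForm (d + 1) s p q) = momForm (d + 1) s q p := by
  simp only [momForm, map_sum, map_mul, Complex.conj_conj]
  rw [Finset.sum_comm]
  refine Finset.sum_congr rfl fun j _ => Finset.sum_congr rfl fun k _ => ?_
  rw [hherm j k (by omega)]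
  ring

lemma momForm_single (n : ℕ) (s : ℕ → ℕ → ℂ) (j k : Fin n) :
    momForm n s (Pi.single j 1) (Pi.single k 1) = s j k := by
  unfold momForm
  rw [Finset.sum_eq_single j, Finset.sum_eq_single k]
  · simp
  · intro b _ hb; simp [Pi.single_eq_of_ne hb]
  · simp
  · intro b _ hb; simp [Pi.single_eq_of_ne hb]
  · simp

/-- The inner product given by the moments. -/
@[reducible]
def momCore (d : ℕ) (s : ℕ → ℕ → ℂ)
    (hherm : ∀ j k : ℕ, j + k ≤ 2 * d + 2 → s j k = (starRingEnd ℂ) (s k j))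
    (hpd : ∀ p : Fin (d + 1) → ℂ, p ≠ 0 → 0 < (momForm (d + 1) s p p).re) :
    InnerProductSpace.Core ℂ (Fin (d + 1) → ℂ) where
  inner p q := momForm (d + 1) s q p
  conj_inner_symm p q := momForm_conj d s hherm _ _
  re_inner_nonneg p := by
    by_cases h : p = 0
    · subst h; simp [momForm]
    · exact (hpd p h).le
  add_left p q r := momForm_add_right _ _ _ _ _
  smul_left p q r := momForm_smul_right _ _ _ _ _
  definite p h := by
    by_contra hp
    have := hpd p hp
    rw [h] at this
    simp at this

lemma forward (d : ℕ) (s : ℕ → ℕ → ℂ)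
    (hherm : ∀ j k : ℕ, j + k ≤ 2 * d + 2 → s j k = (starRingEnd ℂ) (s k j))
    (hpd : ∀ p : Fin (d + 1) → ℂ, p ≠ 0 → 0 < (momForm (d + 1) s p p).re)
    (M : Module.End ℂ (Fin (d + 1) → ℂ))
    (hM : ∀ p q : Fin (d + 1) → ℂ,
      momForm (d + 1) s (M p) q
        = ∑ j : Fin (d + 1), ∑ k : Fin (d + 1),
            p j * (starRingEnd ℂ) (q k) * s ((j : ℕ) + 1) (k : ℕ))
    (h : ∀ p q : Fin (d + 1) → ℂ,
        0 ≤ (momForm (d + 1) s p p).re + (momForm (d + 1) s (M q) (M q)).re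
            + 2 * (momForm (d + 1) s (M p) q).re) :
    ∃ N : ℕ, N ≤ d + 1 ∧ ∃ a : Fin N → ℂ, ∃ c : Fin N → ℝ,
          (∀ m, 0 < c m) ∧
          ∀ j k : ℕ, j ≤ d + 1 → k ≤ d + 1 → j + k ≤ 2 * d + 1 →
            s j k = ∑ m, (c m : ℂ) * a m ^ j * (starRingEnd ℂ) (a m) ^ k := by
  obtain ⟨N, hN, a, c, hc, hac⟩ := core_moments (momCore d s hherm hpd) M h (Pi.single 0 1)
  have hac' : ∀ j k : ℕ, momForm (d + 1) s ((M ^ j) (Pi.single 0 1)) ((M ^ k) (Pi.single 0 1))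
      = ∑ m, (c m : ℂ) * a m ^ j * (starRingEnd ℂ) (a m) ^ k := hac
  have hM1 : ∀ (j : Fin (d + 1)) (q : Fin (d + 1) → ℂ),
      momForm (d + 1) s (M (Pi.single j 1)) q
        = ∑ k : Fin (d + 1), (starRingEnd ℂ) (q k) * s ((j : ℕ) + 1) k := by
    intro j q
    rw [hM, Finset.sum_eq_single j]
    · simp
    · intro b _ hb; simp [Pi.single_eq_of_ne hb]
    · simp
  have hsh : ∀ (j : ℕ) (hj : j + 1 < d + 1),
      M (Pi.single (⟨j, by omega⟩ : Fin (d + 1)) (1 : ℂ)) = Pi.single ⟨j + 1, hj⟩ 1 := by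
    intro j hj
    by_contra hne
    set x := M (Pi.single (⟨j, by omega⟩ : Fin (d + 1)) (1 : ℂ)) with hx
    set y : Fin (d + 1) → ℂ := Pi.single ⟨j + 1, hj⟩ 1 with hy
    have hxy : ∀ q, momForm (d + 1) s x q = momForm (d + 1) s y q := by
      intro q
      symm
      rw [hx, hM1, momForm, Finset.sum_eq_single (⟨j + 1, hj⟩ : Fin (d + 1))]
      · simp [hy]
      · intro b _ hb; simp [hy, Pi.single_eq_of_ne hb]
      · simp
    have h0 := hpd (x - y) (sub_ne_zero.2 hne)
    have h1 := momForm_add_left (d + 1) s (x - y) y (x - y)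
    rw [sub_add_cancel, hxy] at h1
    have h2 : momForm (d + 1) s (x - y) (x - y) = 0 := by linear_combination -h1
    rw [h2] at h0
    simp at h0
  have hpw : ∀ (j : ℕ) (hj : j < d + 1),
      (M ^ j) (Pi.single 0 1) = Pi.single (⟨j, hj⟩ : Fin (d + 1)) (1 : ℂ) := by
    intro j
    induction j with
    | zero => intro hj; simp
    | succ n ih =>
      intro hj
      rw [pow_succ', Module.End.mul_apply, ih (by omega), hsh n hj]
  have hlow : ∀ j k : ℕ, j ≤ d + 1 → k ≤ d →
      s j k = ∑ m, (c m : ℂ) * a m ^ j * (starRingEnd ℂ) (a m) ^ k := by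
    intro j k hj hk
    rw [← hac']
    rcases Nat.lt_or_ge j (d + 1) with h | h
    · rw [hpw j h, hpw k (by omega), momForm_single]
    · obtain rfl : j = d + 1 := by omega
      rw [pow_succ', Module.End.mul_apply, hpw d (by omega), hpw k (by omega), hM1,
        Finset.sum_eq_single (⟨k, by omega⟩ : Fin (d + 1))]
      · simp
      · intro b _ hb; simp [Pi.single_eq_of_ne hb]
      · simp
  refine ⟨N, by simpa using hN, a, c, hc, fun j k hj hk hjk => ?_⟩
  rcases Nat.lt_or_ge k (d + 1) with h | h
  · exact hlow j k hj (by omega)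
  · rw [hherm j k (by omega), hlow k j hk (by omega)]
    simp only [map_sum, map_mul, map_pow, Complex.conj_conj, Complex.conj_ofReal]
    exact Finset.sum_congr rfl fun _ _ => by ring

/-- Evaluation of coefficient vectors at the nodes. -/
def evNodes (n N : ℕ) (a : Fin N → ℂ) : (Fin n → ℂ) →ₗ[ℂ] (Fin N → ℂ) where
  toFun p m := ∑ j : Fin n, p j * a m ^ (j : ℕ)
  map_add' p q := by
    ext m; simp [add_mul, Finset.sum_add_distrib]
  map_smul' r p := by
    ext m; simp [Finset.mul_sum, mul_assoc]

lemma backward (d : ℕ) (s : ℕ → ℕ → ℂ)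
    (hpd : ∀ p : Fin (d + 1) → ℂ, p ≠ 0 → 0 < (momForm (d + 1) s p p).re)
    (M : Module.End ℂ (Fin (d + 1) → ℂ))
    (hM : ∀ p q : Fin (d + 1) → ℂ,
      momForm (d + 1) s (M p) q
        = ∑ j : Fin (d + 1), ∑ k : Fin (d + 1),
            p j * (starRingEnd ℂ) (q k) * s ((j : ℕ) + 1) (k : ℕ))
    (N : ℕ) (hN : N ≤ d + 1) (a : Fin N → ℂ) (c : Fin N → ℝ) (hc : ∀ m, 0 < c m)
    (hs : ∀ j k : ℕ, j ≤ d + 1 → k ≤ d + 1 → j + k ≤ 2 * d + 1 →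
            s j k = ∑ m, (c m : ℂ) * a m ^ j * (starRingEnd ℂ) (a m) ^ k)
    (p q : Fin (d + 1) → ℂ) :
    0 ≤ (momForm (d + 1) s p p).re + (momForm (d + 1) s (M q) (M q)).re
            + 2 * (momForm (d + 1) s (M p) q).re := by
  set E := evNodes (d + 1) N a with hE
  have hEa : ∀ p m, E p m = ∑ j : Fin (d + 1), p j * a m ^ (j : ℕ) := fun _ _ => rfl
  have hgen : ∀ (i : ℕ) (_ : i ≤ 1) (p q : Fin (d + 1) → ℂ),
      ∑ j : Fin (d + 1), ∑ k : Fin (d + 1),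
            p j * (starRingEnd ℂ) (q k) * s ((j : ℕ) + i) (k : ℕ)
      = ∑ m, (c m : ℂ) * a m ^ i * E p m * (starRingEnd ℂ) (E q m) := by
    intro i hi p q
    have : ∀ m, (c m : ℂ) * a m ^ i * E p m * (starRingEnd ℂ) (E q m)
      = ∑ j : Fin (d + 1), ∑ k : Fin (d + 1), p j * (starRingEnd ℂ) (q k) *
          ((c m : ℂ) * a m ^ ((j : ℕ) + i) * (starRingEnd ℂ) (a m) ^ (k : ℕ)) := by
      intro m
      rw [hEa, hEa, map_sum, mul_assoc, Finset.sum_mul_sum, Finset.mul_sum]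
      refine Finset.sum_congr rfl fun j _ => ?_
      rw [Finset.mul_sum]
      refine Finset.sum_congr rfl fun k _ => ?_
      rw [map_mul, map_pow]
      ring
    simp only [this]
    symm
    rw [Finset.sum_comm]
    refine Finset.sum_congr rfl fun j _ => ?_
    rw [Finset.sum_comm]
    refine Finset.sum_congr rfl fun k _ => ?_
    rw [← Finset.mul_sum, hs _ _ (by omega) (by omega) (by omega)]
  have hform : ∀ p q, momForm (d + 1) s p q
      = ∑ m, (c m : ℂ) * E p m * (starRingEnd ℂ) (E q m) := by
    intro p q
    simpa [momForm] using hgen 0 (by omega) p q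
  have hformM : ∀ p q, momForm (d + 1) s (M p) q
      = ∑ m, (c m : ℂ) * a m * E p m * (starRingEnd ℂ) (E q m) := by
    intro p q
    rw [hM]
    simpa using hgen 1 le_rfl p q
  have hinj : Function.Injective E := by
    refine (injective_iff_map_eq_zero E).2 ?_
    intro x hx
    by_contra hne
    have := hpd x hne
    rw [hform, hx] at this
    simp at this
  have hsurj : Function.Surjective E := by
    have h1 := LinearMap.finrank_le_finrank_of_injective hinj
    simp only [Module.finrank_fin_fun] at h1
    exact (LinearMap.injective_iff_surjective_of_finrank_eq_finrank (by simp; omega)).1 hinj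
  have hEM : ∀ p m, E (M p) m = a m * E p m := by
    intro p m
    obtain ⟨q, hq⟩ := hsurj (Pi.single m 1)
    have h1 := hformM p q
    rw [hform, hq, Finset.sum_eq_single m, Finset.sum_eq_single m] at h1
    · have : (c m : ℂ) ≠ 0 := by exact_mod_cast (hc m).ne'
      simp only [Pi.single_eq_same, map_one, mul_one, mul_assoc] at h1
      exact mul_left_cancel₀ this h1
    · intro b _ hb; simp [Pi.single_eq_of_ne hb]
    · simp
    · intro b _ hb; simp [Pi.single_eq_of_ne hb]
    · simp
  rw [hformM p q, hform, hform]
  simp only [hEM, Complex.re_sum, Finset.mul_sum, ← Finset.sum_add_distrib]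
  refine Finset.sum_nonneg fun m _ => ?_
  have key : ∀ (c : ℝ) (x y z : ℂ), ((c : ℂ) * x * (starRingEnd ℂ) x).re
      + ((c : ℂ) * (z * y) * (starRingEnd ℂ) (z * y)).re
      + 2 * ((c : ℂ) * z * x * (starRingEnd ℂ) y).re
      = c * Complex.normSq (x + (starRingEnd ℂ) z * y) := by
    intro c x y z
    simp [Complex.normSq_apply]
    ring
  rw [key]
  exact mul_nonneg (hc m).le (Complex.normSq_nonneg _)

/-- the quadratic form `σ(p,q) = ‖p‖² + ‖Mq‖² + 2Re⟨Mp,q⟩` is positive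
semidefinite on `ℂ_d[z] ⊕ ℂ_d[z]` iff a Gaussian-type quadrature with at most `d+1` nodes
represents the moments `s(j,k)`, `j,k ≤ d+1`, `j+k ≤ 2d+1`. -/
theorem statement2 (d : ℕ) (hd : 1 ≤ d) (s : ℕ → ℕ → ℂ)
    (hherm : ∀ j k : ℕ, j + k ≤ 2 * d + 2 → s j k = (starRingEnd ℂ) (s k j))
    (hrsq : ∀ f : ℕ × ℕ → ℂ, 0 ≤ (sqForm (d + 1) s f).re)
    (hpd : ∀ p : Fin (d + 1) → ℂ, p ≠ 0 → 0 < (momForm (d + 1) s p p).re)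
    (M : Module.End ℂ (Fin (d + 1) → ℂ))
    (hM : ∀ p q : Fin (d + 1) → ℂ,
      momForm (d + 1) s (M p) q
        = ∑ j : Fin (d + 1), ∑ k : Fin (d + 1),
            p j * (starRingEnd ℂ) (q k) * s ((j : ℕ) + 1) (k : ℕ)) :
    (∀ p q : Fin (d + 1) → ℂ,
        0 ≤ (momForm (d + 1) s p p).re + (momForm (d + 1) s (M q) (M q)).re
            + 2 * (momForm (d + 1) s (M p) q).re)
      ↔ ∃ N : ℕ, N ≤ d + 1 ∧ ∃ a : Fin N → ℂ, ∃ c : Fin N → ℝ,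
          (∀ m, 0 < c m) ∧
          ∀ j k : ℕ, j ≤ d + 1 → k ≤ d + 1 → j + k ≤ 2 * d + 1 →
            s j k = ∑ m, (c m : ℂ) * a m ^ j * (starRingEnd ℂ) (a m) ^ k := by
  constructor
  · exact forward d s hherm hpd M hM
  · rintro ⟨N, hN, a, c, hc, hs⟩ p q
    exact backward d s hpd M hM N hN a c hc hs p q
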